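/- arXiv:2605.01592 — 2 statements merged into one kernel-verified Lean document; each statement's English description precedes it below -/
import Mathlib

section
/- Let P be a simple polygon and W a witness set of P; assume Vis(u) equals the closure of its interior for every u ∈ W. Let w ∈ W, let e be a window of Vis(w) with base d, and suppose e lies on a line L passing through w. Let v₁, …, v_m ∈ W be vertices adjacent to w in GCon(W), and for each i let NV_i be a connected component of NVis(W) attached to Vis(w) along e and attached to Vis(v_i) along a window e_i of Vis(v_i). Then: (1) there is a closed half-plane H bounded by L such that Vis(e_i) ∩ Vis(w) ⊆ H for every i ∈ {1, …, m}, where Vis(e_i) = ⋃_{x ∈ e_i} Vis(x); and (2) every point x ∈ Vis(w) ∩ L with x = d or w ∈ [d, x] that belongs to ⋃_{i=1}^m Vis(e_i) satisfies x = d. -/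
open Set

noncomputable section

abbrev Plane := EuclideanSpace ℝ (Fin 2)

/-- A simple polygon, given by a cyclic sequence of at least three distinct vertices
whose closed polygonal boundary curve is a Jordan polygon: two edges intersect exactly
when they are consecutive, and then only in their one shared endpoint. -/
structure SimplePolygon where
  n : ℕ
  three_le : 3 ≤ n
  vertex : ℕ → Plane
  periodic : ∀ i, vertex (i + n) = vertex i
  inj : ∀ i < n, ∀ j < n, vertex i = vertex j → i = j
  jordan : ∀ i < n, ∀ j < n, i ≠ j →
    segment ℝ (vertex i) (vertex (i + 1)) ∩ segment ℝ (vertex j) (vertex (j + 1)) =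
      if j = (i + 1) % n then {vertex (i + 1)}
      else if i = (j + 1) % n then {vertex (j + 1)}
      else ∅

namespace SimplePolygon

/-- The boundary curve of the polygon: the union of its edges. -/
def boundary (P : SimplePolygon) : Set Plane :=
  ⋃ i ∈ Finset.range P.n, segment ℝ (P.vertex i) (P.vertex (i + 1))

/-- The polygon as a region: the boundary together with all bounded connected
components of the complement of the boundary. -/
def region (P : SimplePolygon) : Set Plane :=
  P.boundary ∪ {x | x ∉ P.boundary ∧
    Bornology.IsBounded (connectedComponentIn P.boundaryᶜ x)}

/-- Visibility region of a point `p`: all points `q` of the polygon such that the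
closed segment `[p,q]` is contained in the polygon. -/
def Vis (P : SimplePolygon) (p : Plane) : Set Plane :=
  {q | q ∈ P.region ∧ segment ℝ p q ⊆ P.region}

/-- Visibility region of a set. -/
def VisSet (P : SimplePolygon) (S : Set Plane) : Set Plane :=
  ⋃ p ∈ S, P.Vis p

/-- Two points of the polygon are visible to each other if the segment joining them
lies in the polygon. -/
def Visible (P : SimplePolygon) (p q : Plane) : Prop :=
  p ∈ P.region ∧ q ∈ P.region ∧ segment ℝ p q ⊆ P.region

/-- A witness set: a finite set of points of the polygon with pairwise disjoint
visibility regions. -/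
def IsWitnessSet (P : SimplePolygon) (W : Set Plane) : Prop :=
  W.Finite ∧ W ⊆ P.region ∧
    ∀ x ∈ W, ∀ y ∈ W, x ≠ y → P.Vis x ∩ P.Vis y = ∅

/-- The non-visible region of a witness set. -/
def NVis (P : SimplePolygon) (W : Set Plane) : Set Plane :=
  P.region \ ⋃ w ∈ W, P.Vis w

/-- `Vis p` is regular (has no arms) if it equals the closure of its interior. -/
def VisRegular (P : SimplePolygon) (p : Plane) : Prop :=
  P.Vis p = closure (interior (P.Vis p))

/-- A window of `Vis p`: a non-degenerate closed segment contained in the frontier of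
`Vis p` whose intersection with the frontier of the polygon is exactly its two
endpoints, maximal with these properties. -/
def IsWindow (P : SimplePolygon) (p : Plane) (e : Set Plane) : Prop :=
  ∃ a b : Plane, a ≠ b ∧ e = segment ℝ a b ∧
    e ⊆ frontier (P.Vis p) ∧
    e ∩ frontier P.region = {a, b} ∧
    ∀ a' b' : Plane, a' ≠ b' →
      segment ℝ a' b' ⊆ frontier (P.Vis p) →
      segment ℝ a' b' ∩ frontier P.region = {a', b'} →
      e ⊆ segment ℝ a' b' → e = segment ℝ a' b'

/-- `γ` is (the image of) a neighbor witness path between `w` and `w'`. -/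
def IsNWPath (P : SimplePolygon) (W : Set Plane) (w w' : Plane) (γ : Set Plane) : Prop :=
  ∃ f : Path w w', γ = Set.range f ∧ γ ⊆ P.Vis w ∪ P.NVis W ∪ P.Vis w'

/-- Adjacency in the neighbor witness graph `GCon(W)`. -/
def GConAdj (P : SimplePolygon) (W : Set Plane) (w w' : Plane) : Prop :=
  w ∈ W ∧ w' ∈ W ∧ w ≠ w' ∧ ∃ γ : Set Plane, P.IsNWPath W w w' γ

/-- A connected component `NV` of `NVis W` is attached to `Vis w` if the closure of
`NV` intersects `Vis w`. -/
def Attached (P : SimplePolygon) (NV : Set Plane) (w : Plane) : Prop :=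
  (closure NV ∩ P.Vis w).Nonempty

/-- `w` is a simplicial vertex of `GCon(W)`: its neighbors are pairwise adjacent. -/
def Simplicial (P : SimplePolygon) (W : Set Plane) (w : Plane) : Prop :=
  ∀ u v : Plane, P.GConAdj W w u → P.GConAdj W w v → u ≠ v → P.GConAdj W u v

end SimplePolygon

/-- `NV` is a connected component of `S`. -/
def IsCompOf (NV S : Set Plane) : Prop :=
  ∃ x ∈ S, NV = connectedComponentIn S x

open Filter Topology

theorem Complex.sub_div_sub_mem_slitPlane {A B z : ℂ} (hz : z ∉ segment ℝ A B) :
    (z - A) / (z - B) ∈ Complex.slitPlane := by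
  have hzB : z - B ≠ 0 := fun h => hz (sub_eq_zero.1 h ▸ right_mem_segment ℝ A B)
  by_contra h
  rw [Complex.mem_slitPlane_iff, not_or, not_lt, not_not] at h
  obtain ⟨hre, him⟩ := h
  set t : ℝ := -((z - A) / (z - B)).re with ht
  have hq : (z - A) / (z - B) = -(t : ℂ) := by
    apply Complex.ext <;> simp [ht, him]
  rw [div_eq_iff hzB] at hq
  have ht0 : 0 ≤ t := by simp only [ht]; linarith
  have h1 : (1 + t : ℝ) ≠ 0 := by positivity
  have h1' : (1 + t : ℂ) ≠ 0 := by exact_mod_cast h1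
  refine hz ⟨1 / (1 + t), t / (1 + t), by positivity, by positivity, by field_simp, ?_⟩
  simp only [Complex.real_smul]
  push_cast
  field_simp
  linear_combination -hq

/-- The quotient `(z - A) / (z - B)` has a continuous square root on `S`. -/
def HasContinuousSqrtOn (S : Set ℂ) (A B : ℂ) : Prop :=
  ∃ s : ℂ → ℂ, ContinuousOn s S ∧ ∀ z ∈ S, s z ^ 2 = (z - A) / (z - B)

namespace HasContinuousSqrtOn

theorem mono {S T : Set ℂ} {A B : ℂ} (h : HasContinuousSqrtOn T A B) (hST : S ⊆ T) :
    HasContinuousSqrtOn S A B :=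
  let ⟨s, hc, hs⟩ := h
  ⟨s, hc.mono hST, fun z hz => hs z (hST hz)⟩

theorem trans {S : Set ℂ} {A B C : ℂ} (hB : B ∉ S) (hAB : HasContinuousSqrtOn S A B)
    (hBC : HasContinuousSqrtOn S B C) : HasContinuousSqrtOn S A C := by
  obtain ⟨s, hsc, hs⟩ := hAB
  obtain ⟨t, htc, ht⟩ := hBC
  refine ⟨fun z => s z * t z, hsc.mul htc, fun z hz => ?_⟩
  have : z - B ≠ 0 := fun h => hB (sub_eq_zero.1 h ▸ hz)
  rw [mul_pow, hs z hz, ht z hz]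
  field_simp

theorem symm {S : Set ℂ} {A B : ℂ} (hA : A ∉ S) (hB : B ∉ S) (h : HasContinuousSqrtOn S A B) :
    HasContinuousSqrtOn S B A := by
  obtain ⟨s, hsc, hs⟩ := h
  refine ⟨fun z => (s z)⁻¹, hsc.inv₀ fun z hz h0 => ?_, fun z hz => ?_⟩
  · have := hs z hz
    have hzA : z - A ≠ 0 := fun h => hA (sub_eq_zero.1 h ▸ hz)
    have hzB : z - B ≠ 0 := fun h => hB (sub_eq_zero.1 h ▸ hz)
    rw [h0] at this
    exact div_ne_zero hzA hzB (by simpa using this.symm)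
  · rw [inv_pow, hs z hz, inv_div]

theorem of_disjoint_segment {S : Set ℂ} {A B : ℂ} (h : ∀ z ∈ S, z ∉ segment ℝ A B) :
    HasContinuousSqrtOn S A B := by
  refine ⟨fun z => ((z - A) / (z - B)) ^ (1 / 2 : ℂ), fun z hz => ?_, fun z hz => ?_⟩
  · have hzB : z - B ≠ 0 := fun h' => h z hz (sub_eq_zero.1 h' ▸ right_mem_segment ℝ A B)
    refine ContinuousAt.continuousWithinAt ?_
    refine ContinuousAt.cpow ?_ continuousAt_const (Complex.sub_div_sub_mem_slitPlane (h z hz))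
    exact (continuousAt_id.sub continuousAt_const).div (continuousAt_id.sub continuousAt_const) hzB
  · rw [← Complex.cpow_nat_mul]
    simp

theorem of_isPreconnected_compl {R : Set ℂ} (hR : IsClosed R) (hc : IsPreconnected Rᶜ) {A B : ℂ}
    (hA : A ∉ R) (hB : B ∉ R) : HasContinuousSqrtOn R A B := by
  refine hc.induction₂' (fun A B => HasContinuousSqrtOn R A B) (fun x hx => ?_) ?_ hA hB
  · obtain ⟨ε, hε, hball⟩ := Metric.isOpen_iff.1 hR.isOpen_compl x hx
    filter_upwards [mem_nhdsWithin_of_mem_nhds (Metric.ball_mem_nhds x hε)] with y hy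
    have hseg : segment ℝ x y ⊆ Metric.ball x ε :=
      (convex_ball x ε).segment_subset (Metric.mem_ball_self hε) hy
    refine ⟨of_disjoint_segment fun z hz h => hball (hseg h) hz,
      of_disjoint_segment fun z hz h => hball (hseg (segment_symm ℝ y x ▸ h)) hz⟩
  · intro x y z _ hy _ hxy hyz
    exact hxy.trans hy hyz

end HasContinuousSqrtOn

/-- If the endpoints `0`, `1` of a chord of a compact set `R` without holes are accessible from
the complement, some function continuous on `R` away from the endpoints vanishes only on the chord
and changes its sign across it. -/
theorem exists_sign_change_across_chord {R : Set ℂ} (hR : IsClosed R) (hc : IsPreconnected Rᶜ)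
    {A B : ℂ} (hA : A ∉ R) (hA' : ∀ z ∈ R, z ∈ segment ℝ 0 A → z = 0)
    (hB : B ∉ R) (hB' : ∀ z ∈ R, z ∈ segment ℝ 1 B → z = 1)
    (hint : ∀ p : ℝ, 0 < p → p < 1 → (p : ℂ) ∈ interior R) :
    ∃ g : ℂ → ℝ, ContinuousOn g (R \ {0, 1}) ∧
      (∀ z ∈ R, z ∉ segment ℝ (0 : ℂ) 1 → g z ≠ 0) ∧
      ∀ p : ℝ, 0 < p → p < 1 → ∀ᶠ z in 𝓝 (p : ℂ), z.im ≠ 0 → g z * z.im < 0 := by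
  have hsqrt : HasContinuousSqrtOn (R \ {0, 1}) 0 1 := by
    have h1 : HasContinuousSqrtOn (R \ {0, 1}) 0 A :=
      .of_disjoint_segment fun z hz h => hz.2 (by simp [hA' z hz.1 h])
    have h2 : HasContinuousSqrtOn (R \ {0, 1}) A B :=
      (HasContinuousSqrtOn.of_isPreconnected_compl hR hc hA hB).mono sdiff_subset
    have h3 : HasContinuousSqrtOn (R \ {0, 1}) B 1 :=
      .of_disjoint_segment fun z hz h => hz.2 (by
        rw [segment_symm] at h
        simp [hB' z hz.1 h])
    exact (h1.trans (fun h => hA h.1) h2).trans (fun h => hB h.1) h3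
  obtain ⟨s, hsc, hs⟩ := hsqrt
  have hreal : ∀ p : ℝ, 0 < p → p < 1 → (p : ℂ) ∈ R \ {0, 1} := by
    intro p h0 h1
    refine ⟨interior_subset (hint p h0 h1), ?_⟩
    simp only [mem_insert_iff, mem_singleton_iff, not_or]
    norm_cast
    exact ⟨h0.ne', h1.ne⟩
  have him : ∀ p : ℝ, 0 < p → p < 1 → (s p).im ≠ 0 := by
    intro p h0 h1 h
    have h2 := hs p (hreal p h0 h1)
    have h3 := congrArg Complex.re h2
    have : ((p : ℂ) - 0) / (p - 1) = ((p / (p - 1) : ℝ) : ℂ) := by push_cast; ring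
    rw [this, Complex.ofReal_re, pow_two, Complex.mul_re, h] at h3
    have : p / (p - 1) < 0 := div_neg_of_pos_of_neg h0 (by linarith)
    nlinarith [mul_self_nonneg (s p).re]
  have hcont : ContinuousOn (fun p : ℝ => (s p).im) (Ioo 0 1) :=
    Complex.continuous_im.comp_continuousOn
      (hsc.comp Complex.continuous_ofReal.continuousOn fun p hp => hreal p hp.1 hp.2)
  have hsign : ∀ p : ℝ, 0 < p → p < 1 → 0 < (s p).im * (s (1 / 2 : ℝ)).im := by
    intro p h0 h1
    have hp : p ∈ Ioo (0 : ℝ) 1 := ⟨h0, h1⟩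
    have hh : (1 / 2 : ℝ) ∈ Ioo (0 : ℝ) 1 := by constructor <;> norm_num
    by_contra hneg
    have hpre := (isPreconnected_Ioo (a := (0 : ℝ)) (b := 1)).image _ hcont
    have := (hpre.ordConnected).uIcc_subset (mem_image_of_mem _ hp) (mem_image_of_mem _ hh)
    have h0mem : (0 : ℝ) ∈ uIcc (s p).im (s (1 / 2 : ℝ)).im := by
      rw [mem_uIcc]
      have h2 := him p h0 h1
      rcases lt_or_gt_of_ne h2 with h2 | h2
      · left; exact ⟨h2.le, by by_contra h3; exact hneg (mul_pos_of_neg_of_neg h2 (by linarith))⟩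
      · right; exact ⟨by by_contra h3; exact hneg (mul_pos h2 (by linarith)), h2.le⟩
    obtain ⟨r, hr, hr0⟩ := this h0mem
    exact him r hr.1 hr.2 hr0
  refine ⟨fun z => (s z).re * (s (1 / 2 : ℝ)).im,
    (Complex.continuous_re.comp_continuousOn hsc).mul continuousOn_const, ?_, ?_⟩
  · intro z hz hzseg
    have hz' : z ∈ R \ {0, 1} := by
      refine ⟨hz, ?_⟩
      rintro (rfl | rfl)
      · exact hzseg (left_mem_segment ℝ _ _)
      · exact hzseg (right_mem_segment ℝ _ _)
    refine mul_ne_zero (fun h => ?_) (him _ (by norm_num) (by norm_num))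
    have h2 := Complex.sub_div_sub_mem_slitPlane hzseg
    rw [← hs z hz', Complex.mem_slitPlane_iff, pow_two, Complex.mul_re, Complex.mul_im, h] at h2
    rcases h2 with h2 | h2
    · nlinarith [mul_self_nonneg (s z).im]
    · simp at h2
  · intro p h0 h1
    have hnhds : R \ {0, 1} ∈ 𝓝 (p : ℂ) := by
      have hfin : ({0, 1} : Set ℂ)ᶜ ∈ 𝓝 (p : ℂ) :=
        (Set.toFinite ({0, 1} : Set ℂ)).isClosed.isOpen_compl.mem_nhds (hreal p h0 h1).2
      exact Filter.inter_mem (mem_interior_iff_mem_nhds.1 (hint p h0 h1)) hfin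
    have hsp : ContinuousAt s p := hsc.continuousAt hnhds
    have hpos : ∀ᶠ z in 𝓝 (p : ℂ), 0 < (s z).im * (s (1 / 2 : ℝ)).im :=
      ((Complex.continuous_im.continuousAt.comp hsp).mul continuousAt_const).eventually
        (lt_mem_nhds (hsign p h0 h1))
    filter_upwards [hpos, hnhds] with z hz hzR hzim
    have h2 := congrArg Complex.im (hs z hzR)
    have hz1 : z - 1 ≠ 0 := fun h => hzR.2 (by simp [sub_eq_zero.1 h])
    have hN : 0 < Complex.normSq (z - 1) := Complex.normSq_pos.2 hz1
    have h3 : ((z - 0) / (z - 1)).im = -z.im / Complex.normSq (z - 1) := by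
      rw [Complex.div_im]
      field_simp
      simp
      ring
    rw [h3, pow_two, Complex.mul_im, eq_div_iff hN.ne'] at h2
    have h4 : 0 < z.im ^ 2 := by positivity
    set a := (s z).re
    set b := (s z).im
    set τ := (s (1 / 2 : ℝ)).im
    set N := Complex.normSq (z - 1)
    by_contra hcon
    rw [not_lt] at hcon
    have h5 : z.im = -(2 * a * b * N) := by linarith
    rw [h5] at hcon h4
    have h6 : 0 < a ^ 2 * (b * τ) * (2 * N) := by
      have : a ≠ 0 := by rintro h; simp [h] at h4
      positivity
    nlinarith

/-- If the three sides of a triangle with real base `[a, b]` lie in a bounded set `R` without holes,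
then points close to the base on the side of the apex see the vertex `a` inside `R`. -/
theorem eventually_segment_subset_of_triangle {R : Set ℂ} (hb : Bornology.IsBounded R)
    (hc : IsPreconnected Rᶜ) {a b : ℝ} {y : ℂ} (hy : y.im ≠ 0)
    (hab : segment ℝ (a : ℂ) b ⊆ R) (hay : segment ℝ (a : ℂ) y ⊆ R) (hby : segment ℝ (b : ℂ) y ⊆ R)
    {p : ℝ} (hap : a < p) (hpb : p < b) :
    ∀ᶠ z in 𝓝 (p : ℂ), 0 < z.im * y.im → segment ℝ (a : ℂ) z ⊆ R := by
  have hba : 0 < b - a := by linarith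
  set f : ℂ → ℝ := fun z => z.im / y.im with hf
  set g : ℂ → ℝ := fun z => (z.re - f z * y.re - (1 - f z) * a) / (b - a) with hg
  have hfc : Continuous f := by fun_prop
  have hgc : Continuous g := by fun_prop
  have hrep : ∀ z, (1 - f z - g z) • (a : ℂ) + g z • (b : ℂ) + f z • y = z := by
    intro z
    apply Complex.ext
    · have h : g z * (b - a) = z.re - f z * y.re - (1 - f z) * a := div_mul_cancel₀ _ hba.ne'
      simp only [Complex.add_re, Complex.real_smul, Complex.mul_re, Complex.ofReal_re,
        Complex.ofReal_im]
      linear_combination h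
    · simp [hf]
      field_simp
  set U : Set ℂ := {z | 0 < f z ∧ 0 < g z ∧ 0 < 1 - f z - g z} with hU
  set T : Set ℂ := {z | 0 ≤ f z ∧ 0 ≤ g z ∧ 0 ≤ 1 - f z - g z} with hT
  have hUo : IsOpen U :=
    (isOpen_lt continuous_const hfc).inter ((isOpen_lt continuous_const hgc).inter
      (isOpen_lt continuous_const ((continuous_const.sub hfc).sub hgc)))
  have hTc : IsClosed T :=
    (isClosed_le continuous_const hfc).inter ((isClosed_le continuous_const hgc).inter
      (isClosed_le continuous_const ((continuous_const.sub hfc).sub hgc)))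
  have hUT : U ⊆ T := fun z hz => ⟨hz.1.le, hz.2.1.le, hz.2.2.le⟩
  have hTb : Bornology.IsBounded T := by
    refine (Metric.isBounded_closedBall (x := (0 : ℂ)) (r := ‖(a : ℂ)‖ + ‖(b : ℂ)‖ + ‖y‖)).subset ?_
    rintro z ⟨h1, h2, h3⟩
    rw [mem_closedBall_zero_iff, ← hrep z]
    refine (norm_add₃_le).trans ?_
    rw [norm_smul, norm_smul, norm_smul, Real.norm_of_nonneg h1, Real.norm_of_nonneg h2,
      Real.norm_of_nonneg h3]
    gcongr <;> apply mul_le_of_le_one_left (norm_nonneg _) <;> linarith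
  have hsides : ∀ z ∈ T, z ∉ U → z ∈ R := by
    rintro z ⟨h1, h2, h3⟩ hz
    have hz' : f z = 0 ∨ g z = 0 ∨ 1 - f z - g z = 0 := by
      by_contra! h
      exact hz ⟨h1.lt_of_ne' h.1, h2.lt_of_ne' h.2.1, h3.lt_of_ne' h.2.2⟩
    have hr := hrep z
    rcases hz' with h | h | h
    · refine hab ⟨_, _, h3, h2, by linarith, ?_⟩
      rw [h] at hr ⊢
      simpa using hr
    · refine hay ⟨_, _, h3, h1, by linarith, ?_⟩
      rw [h] at hr ⊢
      simpa using hr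
    · refine hby ⟨_, _, h2, h1, by linarith, ?_⟩
      rw [h] at hr
      simpa using hr
  have hTR : T ⊆ R := by
    have hcover : Rᶜ ⊆ U ∪ Tᶜ := fun z hz => by
      by_contra h
      rw [mem_union, not_or, notMem_compl_iff] at h
      exact hz (hsides z h.2 h.1)
    have hdisj : Disjoint U Tᶜ := disjoint_compl_right.mono_left hUT
    rcases hc.subset_or_subset hUo hTc.isOpen_compl hdisj hcover with h | h
    · exfalso
      have h1 : Bornology.IsBounded (R ∪ Rᶜ) := hb.union (hTb.subset (h.trans hUT))
      rw [union_compl_self] at h1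
      exact NoncompactSpace.noncompact_univ (X := ℂ)
        (Metric.isCompact_of_isClosed_isBounded isClosed_univ h1)
    · exact compl_subset_compl.1 h
  have hfp : f p = 0 := by simp [hf]
  have hgp : g p = (p - a) / (b - a) := by simp [hg, hfp]
  have hg0 : 0 < g p := by rw [hgp]; exact div_pos (by linarith) hba
  have hg1 : 0 < 1 - f p - g p := by
    rw [hgp, hfp, sub_zero, sub_pos, div_lt_one hba]
    linarith
  filter_upwards [hgc.continuousAt.eventually (lt_mem_nhds hg0),
    ((continuous_const.sub hfc).sub hgc).continuousAt.eventually (lt_mem_nhds hg1)]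
    with z hgz hgz' hzy
  have hfz : 0 < f z := by
    have : f z = z.im * y.im / (y.im ^ 2) := by simp only [hf]; field_simp
    rw [this]
    positivity
  rintro u ⟨s, t, hs, ht, hst, rfl⟩
  obtain rfl : s = 1 - t := by linarith
  have hfu : f ((1 - t) • (a : ℂ) + t • z) = t * f z := by simp [hf]; ring
  have hgu : g ((1 - t) • (a : ℂ) + t • z) = t * g z := by
    simp only [hg, hfu]
    simp
    ring
  refine hTR ⟨?_, ?_, ?_⟩
  · rw [hfu]; positivity
  · rw [hgu]; positivity
  · rw [hfu, hgu]
    have : 0 < 1 - f z - g z := hgz'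
    nlinarith [mul_nonneg ht this.le]

theorem Complex.mem_segment_ofReal {a b : ℝ} (hab : a ≤ b) {z : ℂ} :
    z ∈ segment ℝ (a : ℂ) b ↔ z.im = 0 ∧ a ≤ z.re ∧ z.re ≤ b := by
  have h := image_segment ℝ Complex.ofRealCLM.toLinearMap.toAffineMap a b
  simp only [LinearMap.coe_toAffineMap, ContinuousLinearMap.coe_coe, Complex.ofRealCLM_apply,
    segment_eq_Icc hab] at h
  rw [← h]
  constructor
  · rintro ⟨x, hx, rfl⟩
    simpa using hx
  · rintro ⟨him, hre⟩
    exact ⟨z.re, hre, by apply Complex.ext <;> simp [him]⟩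

theorem Complex.mem_segment_zero_one {z : ℂ} :
    z ∈ segment ℝ (0 : ℂ) 1 ↔ z.im = 0 ∧ 0 ≤ z.re ∧ z.re ≤ 1 := by
  simpa using Complex.mem_segment_ofReal (z := z) zero_le_one

/-- Let the chord `[0, 1]` of a compact set `R` without holes be visible from the real point `ω < 0`.
Points that see neighbors of the chord hidden from `ω` across the chord all lie on one side of the
real axis, and are not on the real axis beyond `ω`. -/
theorem exists_visible_side {R : Set ℂ} (hR : IsCompact R) (hc : IsPreconnected Rᶜ)
    {A B : ℂ} (hA : A ∉ R) (hA' : ∀ z ∈ R, z ∈ segment ℝ 0 A → z = 0)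
    (hB : B ∉ R) (hB' : ∀ z ∈ R, z ∈ segment ℝ 1 B → z = 1)
    (hint : ∀ p : ℝ, 0 < p → p < 1 → (p : ℂ) ∈ interior R) {ω : ℝ} (hω : ω < 0)
    (hω1 : segment ℝ (ω : ℂ) 1 ⊆ R)
    (hreg : ((1 / 2 : ℝ) : ℂ) ∈ closure (interior {z | segment ℝ (ω : ℂ) z ⊆ R})) :
    ∃ σ : ℝ, σ ≠ 0 ∧ ∀ N : Set ℂ, IsPreconnected N → N ⊆ R → (∀ z ∈ N, ¬ segment ℝ (ω : ℂ) z ⊆ R) →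
      segment ℝ (0 : ℂ) 1 ⊆ closure N → ∀ x ∈ closure N, ¬ segment ℝ (ω : ℂ) x ⊆ R →
      ∀ y, segment ℝ (ω : ℂ) y ⊆ R → segment ℝ x y ⊆ R →
        0 ≤ σ * y.im ∧ (y.im = 0 → ω < y.re) := by
  obtain ⟨g, hgc, hg0, hgs⟩ := exists_sign_change_across_chord hR.isClosed hc hA hA' hB hB' hint
  have hω1' : ∀ z : ℂ, z.im = 0 → ω ≤ z.re → z.re ≤ 1 → z ∈ R := fun z h1 h2 h3 =>
    hω1 (by simpa using (Complex.mem_segment_ofReal (by linarith : ω ≤ 1)).2 ⟨h1, h2, h3⟩)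
  have hωsub : ∀ z : ℂ, z.im = 0 → ω ≤ z.re → z.re ≤ 1 → segment ℝ (ω : ℂ) z ⊆ R := by
    intro z h1 h2 h3 u hu
    have hz : z = (z.re : ℂ) := by apply Complex.ext <;> simp [h1]
    rw [hz, Complex.mem_segment_ofReal h2] at hu
    exact hω1' u hu.1 hu.2.1 (hu.2.2.trans h3)
  -- the sign is constant on connected sets avoiding the chord
  have hconst : ∀ S : Set ℂ, IsPreconnected S → S ⊆ R → (∀ z ∈ S, z ∉ segment ℝ (0 : ℂ) 1) →
      ∀ x ∈ S, ∀ y ∈ S, 0 < g x * g y := by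
    intro S hS hSR hS' x hx y hy
    have hcont : ContinuousOn g S := hgc.mono fun z hz => ⟨hSR hz, by
      rintro (rfl | rfl)
      · exact hS' _ hz (left_mem_segment ℝ _ _)
      · exact hS' _ hz (right_mem_segment ℝ _ _)⟩
    by_contra hneg
    have hsub := ((hS.image _ hcont).ordConnected).uIcc_subset (mem_image_of_mem _ hx)
      (mem_image_of_mem _ hy)
    have h0 : (0 : ℝ) ∈ uIcc (g x) (g y) := by
      rw [mem_uIcc]
      rcases lt_or_gt_of_ne (hg0 x (hSR hx) (hS' x hx)) with h | h
      · left; exact ⟨h.le, by by_contra h3; exact hneg (mul_pos_of_neg_of_neg h (by linarith))⟩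
      · right; exact ⟨by by_contra h3; exact hneg (mul_pos h (by linarith)), h.le⟩
    obtain ⟨z, hz, hz0⟩ := hsub h0
    exact hg0 z (hSR hz) (hS' z hz) hz0
  have hseg : ∀ x y : ℂ, segment ℝ x y ⊆ R → (∀ z ∈ segment ℝ x y, z ∉ segment ℝ (0 : ℂ) 1) →
      0 < g x * g y := fun x y h1 h2 =>
    hconst _ (convex_segment x y).isPreconnected h1 h2 x (left_mem_segment ℝ _ _) y
      (right_mem_segment ℝ _ _)
  -- visible points off the axis have the sign of `ω`
  have hvis : ∀ z : ℂ, z.im ≠ 0 → segment ℝ (ω : ℂ) z ⊆ R → 0 < g z * g ω := by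
    intro z hz hzR
    rw [mul_comm]
    refine hseg _ _ hzR ?_
    rintro u ⟨s, t, hs, ht, hst, rfl⟩ hu
    rw [Complex.mem_segment_zero_one] at hu
    obtain ⟨h1, h2, -⟩ := hu
    have ht0 : t = 0 := by simpa [hz] using h1
    obtain rfl : s = 1 := by linarith
    simp [ht0] at h2
    linarith
  have htri : ∀ (b : ℝ) (y : ℂ), 0 < b → b ≤ 1 → y.im ≠ 0 → segment ℝ (ω : ℂ) y ⊆ R →
      segment ℝ (b : ℂ) y ⊆ R → ∀ p : ℝ, ω < p → p < b →
      ∀ᶠ z in 𝓝 (p : ℂ), 0 < z.im * y.im → segment ℝ (ω : ℂ) z ⊆ R := by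
    intro b y hb0 hb1 hy h1 h2 p hp hpb
    exact eventually_segment_subset_of_triangle hR.isBounded hc hy
      (hωsub b (by simp) (by simpa using by linarith) (by simpa)) h1 h2 hp hpb
  have hfreq : ∀ (p σ : ℝ), σ ≠ 0 → ∃ᶠ z in 𝓝 (p : ℂ), 0 < z.im * σ := by
    intro p σ hσ
    have hlim : Tendsto (fun t : ℝ => (p : ℂ) + (t * σ : ℝ) * Complex.I) (𝓝[>] 0) (𝓝 (p : ℂ)) := by
      refine Tendsto.mono_left ?_ nhdsWithin_le_nhds
      have : Continuous (fun t : ℝ => (p : ℂ) + (t * σ : ℝ) * Complex.I) := by fun_prop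
      simpa using this.tendsto 0
    refine hlim.frequently (Eventually.frequently ?_)
    filter_upwards [self_mem_nhdsWithin] with t ht
    have : 0 < t * σ ^ 2 := mul_pos ht (by positivity)
    simp
    nlinarith
  -- a point near the middle of the chord that `ω` sees
  obtain ⟨q, hq0, hqω, hqh⟩ : ∃ q : ℂ, q.im ≠ 0 ∧ segment ℝ (ω : ℂ) q ⊆ R ∧
      segment ℝ ((1 / 2 : ℝ) : ℂ) q ⊆ R := by
    obtain ⟨ε, hε, hball⟩ := Metric.mem_nhds_iff.1 (mem_interior_iff_mem_nhds.1
      (hint (1 / 2) (by norm_num) (by norm_num)))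
    obtain ⟨r, hr1, hr2⟩ := mem_closure_iff_nhds.1 hreg _ (Metric.ball_mem_nhds _ hε)
    have hopen : IsOpen (Metric.ball ((1 / 2 : ℝ) : ℂ) ε ∩
        interior {z | segment ℝ (ω : ℂ) z ⊆ R}) := Metric.isOpen_ball.inter isOpen_interior
    have key : ∃ q ∈ Metric.ball ((1 / 2 : ℝ) : ℂ) ε ∩
        interior {z | segment ℝ (ω : ℂ) z ⊆ R}, q.im ≠ 0 := by
      by_cases hr : r.im = 0
      · have hr' : r = (r.re : ℂ) := by apply Complex.ext <;> simp [hr]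
        have hf := hfreq r.re 1 one_ne_zero
        rw [← hr'] at hf
        obtain ⟨z, hz, hz'⟩ := (hf.and_eventually (hopen.mem_nhds ⟨hr1, hr2⟩)).exists
        exact ⟨z, hz', by rintro h; simp [h] at hz⟩
      · exact ⟨r, ⟨hr1, hr2⟩, hr⟩
    obtain ⟨q, ⟨hq1, hq2⟩, hq0⟩ := key
    have hq3 : q ∈ {z | segment ℝ (ω : ℂ) z ⊆ R} := interior_subset hq2
    exact ⟨q, hq0, hq3, ((convex_ball _ _).segment_subset
      (Metric.mem_ball_self hε) hq1).trans hball⟩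
  have hqtri := htri (1 / 2) q (by norm_num) (by norm_num) hq0 hqω hqh
  have hsideneg : ∀ y : ℂ, y.im ≠ 0 → ∀ p : ℝ, 0 < p → p < 1 →
      (∀ᶠ z in 𝓝 (p : ℂ), 0 < z.im * y.im → segment ℝ (ω : ℂ) z ⊆ R) → g ω * y.im < 0 := by
    intro y hy p h0 h1 hev
    obtain ⟨z, hz, hz1, hz2⟩ := ((hfreq p y.im hy).and_eventually (hev.and (hgs p h0 h1))).exists
    have hz0 : z.im ≠ 0 := by rintro h; simp [h] at hz
    have h3 := hvis z hz0 (hz1 hz)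
    have h4 := hz2 hz0
    by_contra hcon
    rw [not_lt] at hcon
    have h5 : 0 < (g z * g ω) * (z.im * y.im) := mul_pos h3 hz
    have h6 : (g z * z.im) * (g ω * y.im) ≤ 0 := mul_nonpos_of_nonpos_of_nonneg h4.le hcon
    nlinarith
  have hωq : g ω * q.im < 0 :=
    hsideneg q hq0 (1 / 4) (by norm_num) (by norm_num)
      (hqtri (1 / 4) (by linarith) (by norm_num))
  have hω0 : g ω ≠ 0 := by rintro h; simp [h] at hωq
  refine ⟨q.im, hq0, fun N hN hNR hNω hNcl x hx hxω y hy hxy => ?_⟩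
  have hNchord : ∀ z ∈ N, z ∉ segment ℝ (0 : ℂ) 1 := by
    intro z hz h
    rw [Complex.mem_segment_zero_one] at h
    exact hNω z hz (hωsub z h.1 (by linarith) h.2.2)
  have hxR : x ∈ R := hxy (left_mem_segment ℝ _ _)
  have hxchord : x ∉ segment ℝ (0 : ℂ) 1 := by
    intro h
    rw [Complex.mem_segment_zero_one] at h
    exact hxω (hωsub x h.1 (by linarith) h.2.2)
  have hgx : g x * g ω < 0 := by
    have hmem : ((1 / 4 : ℝ) : ℂ) ∈ closure N := hNcl (by
      rw [Complex.mem_segment_zero_one]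
      simp only [Complex.ofReal_re, Complex.ofReal_im]
      norm_num)
    have hnear : ∀ᶠ z in 𝓝 ((1 / 4 : ℝ) : ℂ), ω < z.re ∧ z.re < 1 := by
      refine (Complex.continuous_re.continuousAt.eventually (lt_mem_nhds ?_)).and
        (Complex.continuous_re.continuousAt.eventually (gt_mem_nhds ?_))
      · simp only [Complex.ofReal_re]; linarith
      · simp only [Complex.ofReal_re]; norm_num
    obtain ⟨n, hnN, ⟨hn1, hn2⟩, hn3, hn4⟩ := ((mem_closure_iff_frequently.1 hmem).and_eventually
      (hnear.and ((hqtri (1 / 4) (by linarith) (by norm_num)).and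
        (hgs (1 / 4) (by norm_num) (by norm_num))))).exists
    have hn0 : n.im ≠ 0 := fun h => hNω n hnN (hωsub n h hn1.le hn2.le)
    have hnq : n.im * q.im < 0 := by
      by_contra hcon
      exact hNω n hnN (hn3 ((not_lt.1 hcon).lt_of_ne' (mul_ne_zero hn0 hq0)))
    have hgn : g n * g ω < 0 := by
      by_contra hcon
      rw [not_lt] at hcon
      have h5 : 0 < (g ω * q.im) * (g n * n.im) := mul_pos_of_neg_of_neg hωq (hn4 hn0)
      have h6 : (g n * g ω) * (n.im * q.im) ≤ 0 := mul_nonpos_of_nonneg_of_nonpos hcon hnq.le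
      nlinarith
    have hgx0 : g x ≠ 0 := hg0 x hxR hxchord
    have hxmem : x ∈ R \ {0, 1} := ⟨hxR, by
      rintro (rfl | rfl)
      · exact hxchord (left_mem_segment ℝ _ _)
      · exact hxchord (right_mem_segment ℝ _ _)⟩
    by_contra hcon
    have hpos : 0 < g x * g ω := (not_lt.1 hcon).lt_of_ne' (mul_ne_zero hgx0 hω0)
    have hN' : N ⊆ R \ {0, 1} := fun z hz => ⟨hNR hz, by
      rintro (rfl | rfl)
      · exact hNchord _ hz (left_mem_segment ℝ _ _)
      · exact hNchord _ hz (right_mem_segment ℝ _ _)⟩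
    have hcw : ContinuousWithinAt (fun z => g z * g ω) N x :=
      ((hgc x hxmem).mono hN').mul continuousWithinAt_const
    have : (𝓝[N] x).NeBot := mem_closure_iff_nhdsWithin_neBot.1 hx
    obtain ⟨z, hz1, hz2⟩ := ((hcw.eventually (lt_mem_nhds hpos)).and
      (self_mem_nhdsWithin)).exists
    have h1 := hconst N hN hNR hNchord z hz2 n hnN
    have h2 : 0 < (g z * g ω) * (g z * g n) := mul_pos hz1 h1
    have h3 : (g z * g z) * (g n * g ω) ≤ 0 :=
      mul_nonpos_of_nonneg_of_nonpos (mul_self_nonneg _) hgn.le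
    nlinarith
  have hsame : ∀ z : ℂ, 0 < g z * g ω → ¬ 0 < g x * g z := by
    intro z h1 h2
    have h3 : 0 < (g z * g ω) * (g x * g z) := mul_pos h1 h2
    have h4 : (g z * g z) * (g x * g ω) ≤ 0 :=
      mul_nonpos_of_nonneg_of_nonpos (mul_self_nonneg _) hgx.le
    nlinarith
  refine ⟨?_, fun hy0 => ?_⟩
  · by_contra hcon
    rw [not_le] at hcon
    have hy0 : y.im ≠ 0 := by rintro h; simp [h] at hcon
    have hgy := hvis y hy0 hy
    by_cases hmeet : ∀ z ∈ segment ℝ x y, z ∉ segment ℝ (0 : ℂ) 1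
    · exact hsame y hgy (hseg x y hxy hmeet)
    push Not at hmeet
    obtain ⟨p, hp, hp01⟩ := hmeet
    rw [Complex.mem_segment_zero_one] at hp01
    have hpre : p = (p.re : ℂ) := by apply Complex.ext <;> simp [hp01.1]
    rcases hp01.2.1.eq_or_lt with hp0 | hp0
    · have hp0' : p = 0 := by rw [hpre, ← hp0]; simp
      rw [hp0'] at hp
      have hzseg : segment ℝ 0 x ⊆ R :=
        ((convex_segment x y).segment_subset hp (left_mem_segment ℝ _ _)).trans hxy
      obtain ⟨s, t, hs, ht, hst, hcomb⟩ := hp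
      have him : s * x.im + t * y.im = 0 := by simpa using congrArg Complex.im hcomb
      have ht0 : t ≠ 0 := by
        rintro rfl
        obtain rfl : s = 1 := by linarith
        exact hxchord (by simp at hcomb; rw [hcomb]; exact left_mem_segment ℝ _ _)
      have hxq : 0 < x.im * q.im := by
        have h1 : 0 < t * (-(q.im * y.im)) := mul_pos (ht.lt_of_ne' ht0) (by linarith)
        have h2 : s * (x.im * q.im) = t * (-(q.im * y.im)) := by linear_combination q.im * him
        rw [← h2] at h1
        exact pos_of_mul_pos_right h1 hs
      have hlim : Tendsto (fun r : ℝ => (r : ℂ) * x) (𝓝[>] 0) (𝓝 ((0 : ℝ) : ℂ)) := by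
        refine Tendsto.mono_left ?_ nhdsWithin_le_nhds
        have : Continuous (fun r : ℝ => (r : ℂ) * x) := by fun_prop
        simpa using this.tendsto 0
      have hlt1 : ∀ᶠ r : ℝ in 𝓝[>] 0, r < 1 :=
        nhdsWithin_le_nhds (gt_mem_nhds zero_lt_one)
      obtain ⟨r, hr1, hr2, hr3⟩ := ((hlim.eventually (hqtri 0 hω (by norm_num))).and
        (hlt1.and self_mem_nhdsWithin)).exists
      have hr0 : 0 < r := hr3
      have hx0 : x.im ≠ 0 := by rintro h; simp [h] at hxq
      have hrim : ((r : ℂ) * x).im = r * x.im := by simp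
      have hz := hvis ((r : ℂ) * x) (by rw [hrim]; exact mul_ne_zero hr0.ne' hx0)
        (hr1 (by rw [hrim, mul_assoc]; exact mul_pos hr0 hxq))
      refine hsame _ hz (hseg x _ ?_ ?_)
      · refine Subset.trans ((convex_segment 0 x).segment_subset (right_mem_segment ℝ _ _) ?_) hzseg
        exact ⟨1 - r, r, by linarith, hr0.le, by ring, by simp⟩
      · rintro u ⟨a, b, ha, hb, hab, rfl⟩ hu
        rw [Complex.mem_segment_zero_one] at hu
        have h1 : (a + b * r) * x.im = 0 := by
          have := hu.1
          simp at this
          linear_combination this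
        have h2 : a + b * r = 0 := (mul_eq_zero.1 h1).resolve_right hx0
        rcases hb.eq_or_lt with hb | hb
        · rw [← hb] at h2 hab; linarith
        · have := mul_pos hb hr0; linarith
    · have hpy : segment ℝ (p.re : ℂ) y ⊆ R := by
        rw [← hpre]
        exact ((convex_segment x y).segment_subset hp (right_mem_segment ℝ _ _)).trans hxy
      have h1 := hsideneg y hy0 (p.re / 2) (by linarith) (by linarith [hp01.2.2])
        (htri p.re y hp0 hp01.2.2 hy0 hy hpy (p.re / 2) (by linarith) (by linarith))
      have h2 : 0 < (g ω * q.im) * (g ω * y.im) := mul_pos_of_neg_of_neg hωq h1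
      have h3 : (g ω * g ω) * (q.im * y.im) ≤ 0 :=
        mul_nonpos_of_nonneg_of_nonpos (mul_self_nonneg _) hcon.le
      nlinarith
  · by_contra hyω
    rw [not_lt] at hyω
    have hyre : y = (y.re : ℂ) := by apply Complex.ext <;> simp [hy0]
    by_cases hxreal : x.im = 0 ∧ 0 ≤ x.re
    · have hxre : x = (x.re : ℂ) := by apply Complex.ext <;> simp [hxreal.1]
      refine hxω (Subset.trans ?_ hxy)
      intro u hu
      rw [hxre, Complex.mem_segment_ofReal (by linarith)] at hu
      rw [segment_symm, hxre, hyre, Complex.mem_segment_ofReal (by linarith)]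
      exact ⟨hu.1, by linarith, hu.2.2⟩
    · have hgy : 0 < g y * g ω := by
        rw [mul_comm]
        refine hseg _ _ hy fun z hz hz' => ?_
        rw [segment_symm, hyre, Complex.mem_segment_ofReal hyω] at hz
        rw [Complex.mem_segment_zero_one] at hz'
        linarith
      refine hsame y hgy (hseg x y hxy ?_)
      rintro u ⟨a, b, ha, hb, hab, rfl⟩ hu
      rw [Complex.mem_segment_zero_one] at hu
      obtain ⟨h1, h2, -⟩ := hu
      simp [hy0] at h1 h2
      rcases h1 with h1 | h1
      · have : b = 1 := by linarith
        rw [h1, this] at h2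
        linarith
      · have hx0 : x.re < 0 := by
          by_contra h
          exact hxreal ⟨h1, not_lt.1 h⟩
        have hy1 : y.re < 0 := by linarith
        rcases ha.eq_or_lt with ha' | ha'
        · rw [← ha'] at h2 hab; have : b = 1 := by linarith
          rw [this] at h2; linarith
        · nlinarith [mul_neg_of_pos_of_neg ha' hx0, mul_nonneg hb (neg_nonneg.2 hy1.le)]

section NormedSpace

variable {E : Type*} [NormedAddCommGroup E] [NormedSpace ℝ E]

/-- Near each point `a`, a segment agrees with a cone with apex `a`. -/
theorem eventually_segment_conic (u v a : E) :
    ∀ᶠ z in 𝓝 a, (z ∈ segment ℝ u v → a ∈ segment ℝ u v) ∧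
      ∀ t : ℝ, 0 < t → t ≤ 1 → AffineMap.lineMap a z t ∈ segment ℝ u v → z ∈ segment ℝ u v := by
  by_cases ha : a ∈ segment ℝ u v
  · suffices h : ∀ᶠ z in 𝓝 a, ∀ t : ℝ, 0 < t → t ≤ 1 → AffineMap.lineMap a z t ∈ segment ℝ u v →
        z ∈ segment ℝ u v from h.mono fun z hz => ⟨fun _ => ha, hz⟩
    have ha' := ha
    rw [segment_eq_image_lineMap] at ha'
    obtain ⟨r, ⟨hr0, hr1⟩, hra⟩ := ha'
    obtain ⟨δ, hδ, hδ0, hδ1⟩ : ∃ δ > 0, (0 < r → δ ≤ r) ∧ (r < 1 → δ ≤ 1 - r) := by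
      rcases hr0.eq_or_lt with h | h
      · exact ⟨1, one_pos, fun h' => by linarith, fun _ => by linarith⟩
      rcases hr1.eq_or_lt with h' | h'
      · exact ⟨1, one_pos, fun _ => by linarith, fun h' => by linarith⟩
      · exact ⟨min r (1 - r), lt_min h (by linarith), fun _ => min_le_left _ _,
          fun _ => min_le_right _ _⟩
    by_cases huv : v - u = 0
    · obtain rfl : v = u := sub_eq_zero.1 huv
      refine Eventually.of_forall fun z t ht _ hz => ?_
      obtain rfl : v = a := by simpa using hra
      rw [segment_same, mem_singleton_iff, AffineMap.lineMap_apply_module', add_eq_right,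
        smul_eq_zero] at hz
      rw [segment_same, mem_singleton_iff]
      exact sub_eq_zero.1 (hz.resolve_left ht.ne')
    · have hn : 0 < ‖v - u‖ := norm_pos_iff.2 huv
      filter_upwards [Metric.ball_mem_nhds a (mul_pos hδ hn)] with z hz t ht _ hzt
      rw [segment_eq_image_lineMap] at hzt ⊢
      obtain ⟨s, ⟨hs0, hs1⟩, hst⟩ := hzt
      simp only [AffineMap.lineMap_apply_module'] at hra hst
      have hza : z - a = ((s - r) / t) • (v - u) := by
        have h1 : t • (z - a) = (s - r) • (v - u) := by
          rw [sub_smul, eq_sub_of_add_eq hst, eq_sub_of_add_eq hra]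
          abel
        rw [div_eq_inv_mul, mul_smul, ← h1, smul_smul, inv_mul_cancel₀ ht.ne', one_smul]
      have hlt : |(s - r) / t| < δ := by
        rw [Metric.mem_ball, dist_eq_norm, hza, norm_smul, Real.norm_eq_abs] at hz
        exact lt_of_mul_lt_mul_right hz hn.le
      rw [abs_lt] at hlt
      refine ⟨r + (s - r) / t, ⟨?_, ?_⟩, ?_⟩
      · rcases lt_or_ge s r with h | h
        · linarith [hδ0 (by linarith)]
        · have : 0 ≤ (s - r) / t := div_nonneg (by linarith) ht.le
          linarith
      · rcases lt_or_ge r s with h | h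
        · linarith [hδ1 (by linarith)]
        · have : (s - r) / t ≤ 0 := div_nonpos_of_nonpos_of_nonneg (by linarith) ht.le
          linarith
      · rw [AffineMap.lineMap_apply_module', add_smul, ← hza, eq_sub_of_add_eq hra]
        abel
  · have hcl : IsClosed (segment ℝ u v) := by
      rw [segment_eq_image_lineMap]
      exact (isCompact_Icc.image (by fun_prop)).isClosed
    obtain ⟨ε, hε, hball⟩ := Metric.isOpen_iff.1 hcl.isOpen_compl a ha
    filter_upwards [Metric.ball_mem_nhds a hε] with z hz
    refine ⟨fun h => absurd h (hball hz), fun t h0 h1 h => absurd h (hball ?_)⟩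
    refine (convex_ball a ε).segment_subset (Metric.mem_ball_self hε) hz ?_
    rw [segment_eq_image_lineMap]
    exact mem_image_of_mem _ ⟨h0.le, h1⟩

theorem isPreconnected_setOf_lt_norm (h : 1 < Module.rank ℝ E) {r : ℝ} (hr : 0 ≤ r) :
    IsPreconnected {x : E | r < ‖x‖} := by
  have himg : {x : E | r < ‖x‖} =
      (fun p : ℝ × E => p.1 • p.2) '' (Ioi r ×ˢ Metric.sphere (0 : E) 1) := by
    ext x
    constructor
    · intro hx
      have hx0 : ‖x‖ ≠ 0 := (hr.trans_lt hx).ne'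
      refine ⟨(‖x‖, ‖x‖⁻¹ • x), ⟨hx, ?_⟩, ?_⟩
      · simp [norm_smul, hx0]
      · simp [smul_smul, hx0]
    · rintro ⟨⟨t, u⟩, ⟨ht, hu⟩, rfl⟩
      have ht' : r < t := ht
      have hu' : ‖u‖ = 1 := by simpa using hu
      simpa [norm_smul, hu', abs_of_pos (hr.trans_lt ht')] using ht'
  rw [himg]
  exact (isPreconnected_Ioi.prod (isPreconnected_sphere h 0 1)).image _ (by fun_prop)

end NormedSpace

namespace SimplePolygon

variable (P : SimplePolygon)

theorem isCompact_boundary : IsCompact P.boundary := by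
  refine (Finset.range P.n).isCompact_biUnion fun i _ => ?_
  rw [segment_eq_image_lineMap]
  exact isCompact_Icc.image (by fun_prop)

variable {P}

theorem mem_region_of_isPreconnected {S : Set Plane} (hS : IsPreconnected S)
    (hSb : S ⊆ P.boundaryᶜ) {x y : Plane} (hx : x ∈ S) (hy : y ∈ S) (hxR : x ∈ P.region) :
    y ∈ P.region := by
  have hxb := hxR.resolve_left (hSb hx)
  refine Or.inr ⟨hSb hy, ?_⟩
  rw [← connectedComponentIn_eq (hS.subset_connectedComponentIn hx hSb hy)]
  exact hxb.2

variable (P)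

theorem isClosed_region : IsClosed P.region := by
  rw [← isOpen_compl_iff, isOpen_iff_mem_nhds]
  intro x hx
  have hxb : x ∈ P.boundaryᶜ := fun h => hx (Or.inl h)
  have hopen : IsOpen (connectedComponentIn P.boundaryᶜ x) :=
    P.isCompact_boundary.isClosed.isOpen_compl.connectedComponentIn
  filter_upwards [hopen.mem_nhds (mem_connectedComponentIn hxb)] with y hy hyR
  exact hx (mem_region_of_isPreconnected isPreconnected_connectedComponentIn
    (connectedComponentIn_subset _ _) hy (mem_connectedComponentIn hxb) hyR)

theorem exists_isPreconnected_norm_lt : ∃ r : ℝ, 0 ≤ r ∧ {x : Plane | r < ‖x‖} ⊆ P.boundaryᶜ ∧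
    IsPreconnected {x : Plane | r < ‖x‖} := by
  obtain ⟨r, hr⟩ := (Metric.isBounded_iff_subset_closedBall (0 : Plane)).1
    P.isCompact_boundary.isBounded
  refine ⟨max r 0, le_max_right _ _, fun x hx hxb => ?_,
    isPreconnected_setOf_lt_norm ?_ (le_max_right _ _)⟩
  · have h1 := hr hxb
    rw [mem_closedBall_zero_iff] at h1
    exact absurd (h1.trans (le_max_left _ _)) (not_le.2 hx)
  · rw [← Module.finrank_eq_rank]
    simp

theorem not_isBounded_lt_norm (r : ℝ) : ¬ Bornology.IsBounded {x : Plane | r < ‖x‖} := by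
  intro h
  have h1 : Bornology.IsBounded ({x : Plane | r < ‖x‖} ∪ Metric.closedBall 0 r) :=
    h.union Metric.isBounded_closedBall
  have h2 : {x : Plane | r < ‖x‖} ∪ Metric.closedBall 0 r = univ := by
    ext x
    simpa using lt_or_ge r ‖x‖
  rw [h2] at h1
  exact NoncompactSpace.noncompact_univ (X := Plane)
    (Metric.isCompact_of_isClosed_isBounded isClosed_univ h1)

theorem isCompact_region : IsCompact P.region := by
  obtain ⟨r, -, hrb, hpre⟩ := P.exists_isPreconnected_norm_lt
  refine Metric.isCompact_of_isClosed_isBounded P.isClosed_region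
    ((Metric.isBounded_closedBall (x := (0 : Plane)) (r := r)).subset fun x hx => ?_)
  rw [mem_closedBall_zero_iff]
  by_contra hxr
  have hxr' : x ∈ {x : Plane | r < ‖x‖} := not_le.1 hxr
  exact not_isBounded_lt_norm r ((hx.resolve_left (hrb hxr')).2.subset
    (hpre.subset_connectedComponentIn hxr' hrb))

theorem isPreconnected_compl_region : IsPreconnected P.regionᶜ := by
  obtain ⟨r, hr0, hrb, hpre⟩ := P.exists_isPreconnected_norm_lt
  obtain ⟨x₀, hx₀⟩ : {x : Plane | r < ‖x‖}.Nonempty := by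
    by_contra h
    rw [not_nonempty_iff_eq_empty] at h
    exact not_isBounded_lt_norm r (h ▸ Bornology.isBounded_empty)
  refine isPreconnected_of_forall x₀ fun y hy => ?_
  have hyb : y ∈ P.boundaryᶜ := fun h => hy (Or.inl h)
  refine ⟨connectedComponentIn P.boundaryᶜ y, fun z hz hzR => hy ?_, ?_,
    mem_connectedComponentIn hyb, isPreconnected_connectedComponentIn⟩
  · exact mem_region_of_isPreconnected isPreconnected_connectedComponentIn
      (connectedComponentIn_subset _ _) hz (mem_connectedComponentIn hyb) hzR
  · have hunb : ¬ Bornology.IsBounded (connectedComponentIn P.boundaryᶜ y) :=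
      fun h => hy (Or.inr ⟨hyb, h⟩)
    obtain ⟨z, hz, hzr⟩ : ∃ z ∈ connectedComponentIn P.boundaryᶜ y, r < ‖z‖ := by
      by_contra! h
      exact hunb ((Metric.isBounded_closedBall (x := (0 : Plane)) (r := r)).subset
        fun z hz => mem_closedBall_zero_iff.2 (h z hz))
    rw [connectedComponentIn_eq hz]
    exact hpre.subset_connectedComponentIn hzr hrb hx₀

/-- Near each point `a`, the boundary agrees with a cone with apex `a`. -/
theorem eventually_boundary_conic (a : Plane) :
    ∀ᶠ z in 𝓝 a, (z ∈ P.boundary → segment ℝ a z ⊆ P.boundary) ∧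
      ∀ t : ℝ, 0 < t → t ≤ 1 → AffineMap.lineMap a z t ∈ P.boundary → z ∈ P.boundary := by
  filter_upwards [(Filter.eventually_all_finset (Finset.range P.n)).2 fun i _ =>
    eventually_segment_conic (P.vertex i) (P.vertex (i + 1)) a] with z hz
  simp only [boundary, mem_iUnion]
  constructor
  · rintro ⟨i, hi, hzi⟩
    refine Subset.trans ((convex_segment _ _).segment_subset ((hz i hi).1 hzi) hzi) ?_
    exact subset_biUnion_of_mem (u := fun i => segment ℝ (P.vertex i) (P.vertex (i + 1))) hi
  · rintro t h0 h1 ⟨i, hi, hzi⟩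
    exact ⟨i, hi, (hz i hi).2 t h0 h1 hzi⟩

variable {P}

theorem mem_region_iff_of_conic {a z : Plane} (hz : z ∉ P.boundary)
    (h : ∀ t : ℝ, 0 < t → t ≤ 1 → AffineMap.lineMap a z t ∈ P.boundary → z ∈ P.boundary)
    {t : ℝ} (h0 : 0 < t) (h1 : t ≤ 1) :
    AffineMap.lineMap a z t ∈ P.region ↔ z ∈ P.region := by
  have hpre : IsPreconnected (AffineMap.lineMap a z '' Ioc (0 : ℝ) 1) :=
    isPreconnected_Ioc.image _ (by fun_prop)
  have hsub : AffineMap.lineMap a z '' Ioc (0 : ℝ) 1 ⊆ P.boundaryᶜ := by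
    rintro _ ⟨s, hs, rfl⟩ hb
    exact hz (h s hs.1 hs.2 hb)
  have hzm : z ∈ AffineMap.lineMap a z '' Ioc (0 : ℝ) 1 := ⟨1, by simp, by simp⟩
  have htm := mem_image_of_mem (AffineMap.lineMap a z) (show t ∈ Ioc (0 : ℝ) 1 from ⟨h0, h1⟩)
  exact ⟨mem_region_of_isPreconnected hpre hsub htm hzm,
    mem_region_of_isPreconnected hpre hsub hzm htm⟩

theorem eventually_segment_subset_region {a : Plane} (ha : a ∈ P.region) :
    ∀ᶠ z in 𝓝 a, z ∈ P.region → segment ℝ a z ⊆ P.region := by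
  filter_upwards [P.eventually_boundary_conic a] with z hz hzR
  by_cases hzb : z ∈ P.boundary
  · exact (hz.1 hzb).trans fun x hx => Or.inl hx
  · rw [segment_eq_image_lineMap]
    rintro _ ⟨t, ⟨h0, h1⟩, rfl⟩
    rcases h0.eq_or_lt with rfl | h0
    · simpa using ha
    · exact (mem_region_iff_of_conic hzb hz.2 h0 h1).2 hzR

/-- Frontier points of a simple polygon are accessible from the complement along a segment. -/
theorem exists_accessible_of_mem_frontier {a : Plane} (ha : a ∈ frontier P.region) :
    ∃ A, A ∉ P.region ∧ ∀ z ∈ P.region, z ∈ segment ℝ a A → z = a := by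
  have hcl : a ∈ closure P.regionᶜ := by
    rw [frontier_eq_closure_inter_closure] at ha
    exact ha.2
  obtain ⟨A, hA, hA'⟩ :=
    ((mem_closure_iff_frequently.1 hcl).and_eventually (P.eventually_boundary_conic a)).exists
  refine ⟨A, hA, fun z hz hzA => ?_⟩
  rw [segment_eq_image_lineMap] at hzA
  obtain ⟨t, ⟨h0, h1⟩, rfl⟩ := hzA
  rcases h0.eq_or_lt with rfl | h0
  · simp
  · exact absurd ((mem_region_iff_of_conic (fun h => hA (Or.inl h)) hA'.2 h0 h1).1 hz) hA

theorem VisRegular.isClosed {p : Plane} (h : P.VisRegular p) : IsClosed (P.Vis p) := by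
  rw [VisRegular] at h
  rw [h]
  exact isClosed_closure

theorem mem_vis_iff {p q : Plane} : q ∈ P.Vis p ↔ segment ℝ p q ⊆ P.region :=
  ⟨fun h => h.2, fun h => ⟨h (right_mem_segment ℝ p q), h⟩⟩

theorem not_mem_window {p : Plane} (hp : p ∈ P.region) {e : Set Plane} (he : P.IsWindow p e) :
    p ∉ e := by
  obtain ⟨a, b, hab, rfl, hfr, hends, -⟩ := he
  intro hpe
  have hev : ∀ᶠ z in 𝓝 p, z ∈ P.Vis p ↔ z ∈ P.region := by
    filter_upwards [eventually_segment_subset_region hp] with z hz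
    exact ⟨fun h => h.1, fun h => mem_vis_iff.2 (hz h)⟩
  have hcl : p ∈ closure (openSegment ℝ a b) := segment_subset_closure_openSegment hpe
  obtain ⟨z, hz, hzev⟩ :=
    ((mem_closure_iff_frequently.1 hcl).and_eventually hev.eventually_nhds).exists
  have hzs : z ∈ segment ℝ a b := openSegment_subset_segment ℝ a b hz
  have hzfr : z ∈ frontier P.region := by
    have h1 := hfr hzs
    rw [frontier_eq_closure_inter_closure, mem_inter_iff, mem_closure_iff_frequently,
      mem_closure_iff_frequently] at h1 ⊢
    exact ⟨(h1.1.and_eventually hzev).mono fun x hx => hx.2.1 hx.1,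
      (h1.2.and_eventually hzev).mono fun x hx h => hx.1 (hx.2.2 h)⟩
  have hz2 : z ∈ ({a, b} : Set Plane) := hends ▸ ⟨hzs, hzfr⟩
  rcases hz2 with rfl | rfl
  · exact hab (left_mem_openSegment_iff.1 hz)
  · exact hab (right_mem_openSegment_iff.1 hz)

end SimplePolygon

/-- Affine coordinates of the plane in which two given points become `0` and `1`. -/
theorem exists_chord_coordinates {d b : Plane} (hdb : d ≠ b) :
    ∃ (ψ : ℂ ≃ₜ Plane) (F : Plane →L[ℝ] ℝ), F ≠ 0 ∧ (∀ z, F (ψ z) = F d + z.im) ∧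
      (∀ t : ℝ, ψ t = AffineMap.lineMap d b t) ∧
      ∀ x y, ψ '' segment ℝ x y = segment ℝ (ψ x) (ψ y) := by
  set J : Plane ≃ₗᵢ[ℝ] ℂ := Complex.orthonormalBasisOneI.repr.symm with hJ
  set κ : ℂ := J b - J d with hκdef
  have hκ : κ ≠ 0 := fun h => hdb (J.injective (sub_eq_zero.1 h)).symm
  set ψ : ℂ ≃ₜ Plane := ((Homeomorph.mulRight₀ κ hκ).trans (Homeomorph.addRight (J d))).trans
    J.symm.toHomeomorph with hψdef
  have hψ : ∀ z, ψ z = J.symm (z * κ + J d) := fun z => rfl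
  set F : Plane →L[ℝ] ℝ := Complex.imCLM ∘L
    ((ContinuousLinearMap.mul ℝ ℂ κ⁻¹) ∘L (J.toContinuousLinearEquiv : Plane →L[ℝ] ℂ)) with hFdef
  have hF : ∀ x, F x = (κ⁻¹ * J x).im := fun x => rfl
  have hFψ : ∀ z, F (ψ z) = F d + z.im := by
    intro z
    rw [hF, hF, hψ, J.apply_symm_apply, mul_add, mul_comm z, inv_mul_cancel_left₀ hκ,
      Complex.add_im, add_comm]
  refine ⟨ψ, F, ?_, hFψ, ?_, ?_⟩
  · intro h
    have := hFψ Complex.I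
    simp [h] at this
  · intro t
    rw [hψ, AffineMap.lineMap_apply_module', hκdef, ← Complex.real_smul, map_add, map_smul, map_sub]
    simp
  · intro x y
    let φ : ℂ →ᵃ[ℝ] Plane :=
      ((J.symm.toLinearEquiv : ℂ →ₗ[ℝ] Plane) ∘ₗ (LinearMap.mulRight ℝ κ)).toAffineMap +
        AffineMap.const ℝ ℂ d
    have hφ : ⇑φ = ψ := by
      funext z
      rw [hψ, map_add, J.symm_apply_apply]
      rfl
    rw [← hφ]
    exact image_segment ℝ φ x y

theorem affineSubspace_eq_line_of_mem {L : AffineSubspace ℝ Plane}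
    (hL : ∃ u u' : Plane, u ≠ u' ∧ L = affineSpan ℝ {u, u'}) {d b : Plane} (hdb : d ≠ b)
    (hd : d ∈ L) (hb : b ∈ L) : ∀ x, x ∈ L ↔ ∃ t : ℝ, AffineMap.lineMap d b t = x := by
  obtain ⟨u, u', -, rfl⟩ := hL
  intro x
  constructor
  · intro hx
    rw [mem_affineSpan_pair_iff_exists_lineMap_eq] at hd hb hx
    obtain ⟨r, rfl⟩ := hd
    obtain ⟨s, rfl⟩ := hb
    obtain ⟨q, rfl⟩ := hx
    have hrs : s - r ≠ 0 := by
      intro h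
      exact hdb (by rw [sub_eq_zero.1 h])
    refine ⟨(q - r) / (s - r), ?_⟩
    simp only [AffineMap.lineMap_apply_module']
    match_scalars <;> field_simp <;> ring
  · rintro ⟨t, rfl⟩
    exact AffineMap.lineMap_mem t hd hb

/-- The endpoint of a segment closest to a collinear point outside of it. -/
theorem exists_lineMap_neg_of_closest {a b w d : Plane} {t : ℝ}
    (hw : AffineMap.lineMap a b t = w) (hab : a ≠ b) (hwe : w ∉ segment ℝ a b)
    (hd : d ∈ segment ℝ a b) (hclosest : ∀ x ∈ segment ℝ a b, dist w d ≤ dist w x) :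
    ∃ b', b' ≠ d ∧ segment ℝ d b' = segment ℝ a b ∧ ({d, b'} : Set Plane) = {a, b} ∧
      ∃ ω : ℝ, ω < 0 ∧ AffineMap.lineMap d b' ω = w := by
  have hD : 0 < dist a b := dist_pos.2 hab
  have hd' := hd
  rw [segment_eq_image_lineMap] at hd'
  obtain ⟨s, ⟨hs0, hs1⟩, hs⟩ := hd'
  have ha := hclosest a (left_mem_segment ℝ a b)
  have hb := hclosest b (right_mem_segment ℝ a b)
  rw [← hw, ← hs, dist_lineMap_lineMap, Real.dist_eq] at ha hb
  rw [dist_lineMap_left, Real.norm_eq_abs] at ha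
  rw [dist_lineMap_right, Real.norm_eq_abs] at hb
  replace ha := le_of_mul_le_mul_right ha hD
  replace hb := le_of_mul_le_mul_right hb hD
  rcases lt_or_ge t 0 with ht | ht
  · rw [abs_of_nonpos (by linarith), abs_of_neg ht] at ha
    obtain rfl : s = 0 := by linarith
    obtain rfl : a = d := by simpa using hs
    exact ⟨b, hab.symm, rfl, rfl, t, ht, hw⟩
  · rcases lt_or_ge 1 t with ht1 | ht1
    · rw [abs_of_nonneg (by linarith), abs_of_neg (by linarith)] at hb
      obtain rfl : s = 1 := by linarith
      obtain rfl : b = d := by simpa using hs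
      exact ⟨a, hab, segment_symm ℝ _ _, pair_comm _ _, 1 - t, by linarith, by
        rw [AffineMap.lineMap_apply_one_sub, hw]⟩
    · exfalso
      refine hwe ?_
      rw [segment_eq_image_lineMap, ← hw]
      exact mem_image_of_mem _ ⟨ht, ht1⟩

/-- All restricted visibility regions of neighbor windows attached along
a common window `e` of `Vis w` lie in one closed half-plane bounded by the supporting
line of `e`, and on the ray of that line beyond `w` they can meet only the base `d`. -/
theorem vis_windows_one_side (P : SimplePolygon) (W : Set Plane)
    (hW : P.IsWitnessSet W) (hreg : ∀ u ∈ W, P.VisRegular u)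
    (w : Plane) (hw : w ∈ W)
    (e : Set Plane) (he : P.IsWindow w e)
    (d : Plane) (hd : d ∈ e) (hdbase : ∀ x ∈ e, dist w d ≤ dist w x)
    (L : AffineSubspace ℝ Plane)
    (hLline : ∃ u u' : Plane, u ≠ u' ∧ L = affineSpan ℝ {u, u'})
    (hwL : w ∈ L) (heL : e ⊆ (L : Set Plane))
    (m : ℕ) (v : ℕ → Plane) (NV : ℕ → Set Plane) (ev : ℕ → Set Plane)
    (hadj : ∀ i < m, P.GConAdj W w (v i))
    (hNVcomp : ∀ i < m, IsCompOf (NV i) (P.NVis W))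
    (hNVe : ∀ i < m, e ⊆ closure (NV i))
    (hev : ∀ i < m, P.IsWindow (v i) (ev i))
    (hevNV : ∀ i < m, ev i ⊆ closure (NV i)) :
    (∃ (f : Plane →L[ℝ] ℝ) (c : ℝ), f ≠ 0 ∧ (L : Set Plane) = {x | f x = c} ∧
        ∀ i < m, P.VisSet (ev i) ∩ P.Vis w ⊆ {x | f x ≤ c}) ∧
      (∀ x ∈ P.Vis w, x ∈ L → (x = d ∨ w ∈ segment ℝ d x) →
        x ∈ ⋃ i ∈ Finset.range m, P.VisSet (ev i) → x = d) := by
  have hwe : w ∉ e := SimplePolygon.not_mem_window (hW.2.1 hw) he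
  obtain ⟨a, b₀, hab₀, rfl, hfr, hends, -⟩ := he
  obtain ⟨t, ht⟩ := (affineSubspace_eq_line_of_mem hLline hab₀ (heL (left_mem_segment ℝ _ _))
    (heL (right_mem_segment ℝ _ _)) w).1 hwL
  obtain ⟨b, hbd, hseg, hpair, ω, hω, hωw⟩ := exists_lineMap_neg_of_closest ht hab₀ hwe hd hdbase
  rw [← hpair, ← hseg] at hends
  rw [← hseg] at hfr heL hNVe
  have hdL : d ∈ L := heL (left_mem_segment ℝ _ _)
  have hbL : b ∈ L := heL (right_mem_segment ℝ _ _)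
  have hLmem := affineSubspace_eq_line_of_mem hLline hbd.symm hdL hbL
  obtain ⟨ψ, F, hF0, hFψ, hψline, hψseg⟩ := exists_chord_coordinates hbd.symm
  have hψ0 : ψ 0 = d := by simpa using hψline 0
  have hψ1 : ψ 1 = b := by simpa using hψline 1
  have hψω : ψ ω = w := by rw [hψline, hωw]
  have hLF : ∀ x, x ∈ L ↔ F x = F d := by
    intro x
    obtain ⟨z, rfl⟩ := ψ.surjective x
    rw [hLmem, hFψ, add_eq_left]
    constructor
    · rintro ⟨s, hs⟩
      rw [← hψline, ψ.injective.eq_iff] at hs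
      rw [← hs, Complex.ofReal_im]
    · intro hz
      refine ⟨z.re, ?_⟩
      rw [← hψline]
      congr 1
      apply Complex.ext <;> simp [hz]
  have hsubset : ∀ x y, segment ℝ x y ⊆ ψ ⁻¹' P.region ↔
      segment ℝ (ψ x) (ψ y) ⊆ P.region := by
    intro x y
    rw [← hψseg, image_subset_iff]
  have hvis : ∀ z, segment ℝ (ω : ℂ) z ⊆ ψ ⁻¹' P.region ↔ ψ z ∈ P.Vis w := by
    intro z
    rw [hsubset, hψω, SimplePolygon.mem_vis_iff]
  have hVcl : IsClosed (P.Vis w) := (hreg w hw).isClosed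
  have hevis : segment ℝ d b ⊆ P.Vis w := hfr.trans hVcl.frontier_subset
  have hmem01 : ∀ z, z ∈ segment ℝ (0 : ℂ) 1 → ψ z ∈ segment ℝ d b := by
    intro z hz
    rw [← hψ0, ← hψ1, ← hψseg]
    exact mem_image_of_mem _ hz
  have hacc : ∀ z : ℂ, ψ z ∈ frontier P.region →
      ∃ A ∉ ψ ⁻¹' P.region, ∀ u ∈ ψ ⁻¹' P.region, u ∈ segment ℝ z A → u = z := by
    intro z hz
    obtain ⟨A, hA, hA'⟩ := SimplePolygon.exists_accessible_of_mem_frontier hz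
    obtain ⟨A, rfl⟩ := ψ.surjective A
    refine ⟨A, hA, fun u hu huA => ψ.injective (hA' _ hu ?_)⟩
    rw [← hψseg]
    exact mem_image_of_mem _ huA
  have hdfr : d ∈ frontier P.region := (hends.ge (Or.inl rfl)).2
  have hbfr : b ∈ frontier P.region := (hends.ge (Or.inr rfl)).2
  obtain ⟨A, hA, hA'⟩ := hacc 0 (by rwa [hψ0])
  obtain ⟨B, hB, hB'⟩ := hacc 1 (by rwa [hψ1])
  have hint : ∀ p : ℝ, 0 < p → p < 1 → (p : ℂ) ∈ interior (ψ ⁻¹' P.region) := by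
    intro p h0 h1
    rw [← ψ.preimage_interior, mem_preimage]
    have hp : ψ p ∈ segment ℝ d b := hmem01 _ (by
      rw [Complex.mem_segment_zero_one]
      exact ⟨by simp, by simpa using h0.le, by simpa using h1.le⟩)
    by_contra hp'
    have hpfr : ψ p ∈ frontier P.region := ⟨subset_closure (hevis hp).1, hp'⟩
    have : ψ p ∈ ({d, b} : Set Plane) := hends ▸ ⟨hp, hpfr⟩
    rw [← hψ0, ← hψ1, mem_insert_iff, mem_singleton_iff, ψ.injective.eq_iff,
      ψ.injective.eq_iff] at this
    norm_cast at this
    rcases this with h | h <;> linarith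
  have hregω : ((1 / 2 : ℝ) : ℂ) ∈
      closure (interior {z | segment ℝ (ω : ℂ) z ⊆ ψ ⁻¹' P.region}) := by
    have : {z | segment ℝ (ω : ℂ) z ⊆ ψ ⁻¹' P.region} = ψ ⁻¹' P.Vis w := by
      ext z
      exact hvis z
    rw [this, ← ψ.preimage_interior, ← ψ.preimage_closure, mem_preimage]
    have h := hreg w hw
    rw [SimplePolygon.VisRegular] at h
    rw [← h]
    exact hevis (hmem01 _ (by
      rw [Complex.mem_segment_zero_one]
      simp only [Complex.ofReal_re, Complex.ofReal_im]
      norm_num))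
  obtain ⟨σ, hσ, hside⟩ := exists_visible_side (ψ.isCompact_preimage.2 P.isCompact_region)
    (ψ.isPreconnected_preimage.2 P.isPreconnected_compl_region) hA hA' hB hB' hint hω
    ((hvis 1).2 (hevis (hmem01 1 (right_mem_segment ℝ _ _)))) hregω
  have hmain : ∀ i < m, ∀ z, ψ z ∈ P.VisSet (ev i) → ψ z ∈ P.Vis w →
      0 ≤ σ * z.im ∧ (z.im = 0 → ω < z.re) := by
    intro i hi z hz hzw
    simp only [SimplePolygon.VisSet, mem_iUnion] at hz
    obtain ⟨x, hx, hxz⟩ := hz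
    obtain ⟨x, rfl⟩ := ψ.surjective x
    obtain ⟨-, hvW, hwv, -⟩ := hadj i hi
    obtain ⟨x₀, -, hNV⟩ := hNVcomp i hi
    have hNVsub : NV i ⊆ P.NVis W := hNV ▸ connectedComponentIn_subset _ _
    have hNVpre : IsPreconnected (NV i) := hNV ▸ isPreconnected_connectedComponentIn
    have hxvis : ψ x ∉ P.Vis w := by
      intro h
      obtain ⟨a', b', -, -, hfr', -⟩ := hev i hi
      have hmem : ψ x ∈ P.Vis w ∩ P.Vis (v i) :=
        ⟨h, (hreg _ hvW).isClosed.frontier_subset (hfr' hx)⟩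
      rw [hW.2.2 w hw (v i) hvW hwv] at hmem
      exact hmem
    refine hside (ψ ⁻¹' NV i) (ψ.isPreconnected_preimage.2 hNVpre)
      (fun u hu => (hNVsub hu).1) (fun u hu h => (hNVsub hu).2 ?_) (fun u hu => ?_) x ?_ ?_ z ?_ ?_
    · exact mem_biUnion hw ((hvis u).1 h)
    · rw [← ψ.preimage_closure]
      exact hNVe i hi (hmem01 u hu)
    · rw [← ψ.preimage_closure]
      exact hevNV i hi hx
    · rwa [hvis]
    · rwa [hvis]
    · rw [hsubset]
      exact hxz.2
  refine ⟨⟨(-σ) • F, -σ * F d, smul_ne_zero (neg_ne_zero.2 hσ) hF0, ?_, ?_⟩, ?_⟩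
  · ext x
    simp [hLF, hσ]
  · rintro i hi y ⟨hy1, hy2⟩
    obtain ⟨z, rfl⟩ := ψ.surjective y
    have := (hmain i hi z hy1 hy2).1
    simp only [mem_ofPred_eq, smul_apply, smul_eq_mul, hFψ]
    linarith
  · rintro x hxw hxL hx hxU
    rcases hx with hx | hx
    · exact hx
    exfalso
    simp only [mem_iUnion, Finset.mem_range] at hxU
    obtain ⟨i, hi, hxi⟩ := hxU
    obtain ⟨z, rfl⟩ := ψ.surjective x
    have hz0 : z.im = 0 := by
      rw [hLF, hFψ] at hxL
      linarith
    have hlt := (hmain i hi z hxi hxw).2 hz0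
    rw [← hψω, ← hψ0, ← hψseg] at hx
    obtain ⟨u, hu, hu'⟩ := hx
    rw [ψ.injective hu'] at hu
    obtain ⟨s, r, hs, hr, hsr, hcomb⟩ := hu
    have hre : r * z.re = ω := by simpa using congrArg Complex.re hcomb
    rcases le_or_gt 0 z.re with h | h
    · nlinarith [mul_nonneg hr h]
    · nlinarith
end
end

section
/- Let P ⊆ ℝ² be any set, let W ⊆ P be a finite witness set of P, and let G ⊆ P be a finite set with Vis(G) = P (i.e., G is a guard set: every point of P is visible from some point of G). Then |W| ≤ |G|. -/
open Set

noncomputable section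

/-- Visibility region of a point `p` in an arbitrary set `P ⊆ ℝ²`. -/
def VisIn (P : Set Plane) (p : Plane) : Set Plane :=
  {q | q ∈ P ∧ segment ℝ p q ⊆ P}

theorem mem_visIn_symm {P : Set Plane} {p q : Plane} (hp : p ∈ P) (h : q ∈ VisIn P p) :
    p ∈ VisIn P q :=
  ⟨hp, segment_symm ℝ p q ▸ h.2⟩

/-- A witness set is never larger than a guard set. -/
theorem witness_le_guard (P : Set Plane) (W G : Set Plane)
    (hWP : W ⊆ P) (hGP : G ⊆ P) (hWfin : W.Finite) (hGfin : G.Finite)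
    (hwit : ∀ x ∈ W, ∀ y ∈ W, x ≠ y → VisIn P x ∩ VisIn P y = ∅)
    (hguard : ⋃ g ∈ G, VisIn P g = P) :
    W.ncard ≤ G.ncard := by
  have hex : ∀ w ∈ W, ∃ g ∈ G, w ∈ VisIn P g := fun w hw => by
    have hw' := hWP hw
    rw [← hguard] at hw'
    simpa using hw'
  choose! f hfG hf using hex
  have hsee : ∀ w ∈ W, f w ∈ VisIn P w := fun w hw =>
    mem_visIn_symm (hGP (hfG w hw)) (hf w hw)
  refine ncard_le_ncard_of_injOn f hfG (fun x hx y hy hxy => ?_) hGfin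
  by_contra hne
  have hmem : f x ∈ VisIn P x ∩ VisIn P y := ⟨hsee x hx, hxy ▸ hsee y hy⟩
  simp [hwit x hx y hy hne] at hmem
end
end
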